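/- arXiv:1805.06979 — 4 statements merged into one kernel-verified Lean document; each statement's English description precedes it below -/
import Mathlib

section
/- Let G be a finite abelian group of order n whose Sylow 2-subgroups are cyclic and nontrivial. Then χ(G) ≤ n + 2. -/
/-- Exactly one of three propositions holds. -/
def ExactlyOne (p q r : Prop) : Prop :=
  (p ∧ ¬q ∧ ¬r) ∨ (¬p ∧ q ∧ ¬r) ∨ (¬p ∧ ¬q ∧ r)

/-- The Cayley table graph of a group `G`: vertices are cells `(a, b)` of the Cayley
table, and distinct cells are adjacent iff exactly one of same row, same column,
same symbol (`a * b`) holds. -/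
def cayleyGraph (G : Type*) [Group G] : SimpleGraph (G × G) :=
  SimpleGraph.fromRel fun p q =>
    ExactlyOne (p.1 = q.1) (p.2 = q.2) (p.1 * p.2 = q.1 * q.2)


def TGood (X : Type*) [AddCommGroup X] : Prop :=
  (∀ x y : X, x + x = y + y → x = y) ∧
  (∃ θ : X → X, (∀ x y, θ x = θ y → x = y) ∧ (∀ x y, θ x + x = θ y + y → x = y) ∧
    (∀ x y, θ x + (θ x + x) = θ y + (θ y + y) → x = y)) ∧
  ∃ π : X → X, (∀ x y, π x = π y → x = y) ∧ (∀ x y, x + π x = y + π y → x = y) ∧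
    ∀ b, ∃ κ : X → Bool, (∀ x, π x = b → κ (π x) = κ x) ∧ (∀ x, π x ≠ b → κ (π x) = !κ x)

open Classical in
lemma TGood.ext {A B C : Type*} [AddCommGroup A] [AddCommGroup B] [AddCommGroup C]
    (i : B →+ A) (q : A →+ C) (r : C → A) (z : A → B)
    (hi : Function.Injective i) (hr : ∀ c, q (r c) = c) (hq : ∀ b, q (i b) = 0)
    (hz : ∀ x, i (z x) = x - r (q x)) (hB : TGood B) (hC : TGood C) : TGood A := by
  obtain ⟨dB, ⟨θB, hθ1, hθ2, hθ3⟩, πB, hπ1, hπ2, hκB⟩ := hB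
  obtain ⟨dC, ⟨θC, hφ1, hφ2, hφ3⟩, πC, hρ1, hρ2, hκC⟩ := hC
  have hx : ∀ x, x = r (q x) + i (z x) := by intro x; rw [hz]; abel
  have hE : ∀ x y, q x = q y → z x = z y → x = y := by
    intro x y h1 h2; rw [hx x, hx y, h1, h2]
  have hzr : ∀ c b, z (r c + i b) = b := by
    intro c b; apply hi; rw [hz]; simp [hr, hq]
  have hqr : ∀ c b, q (r c + i b) = c := by
    intro c b; simp [hr, hq]
  refine ⟨?_, ⟨fun x => r (θC (q x)) + i (θB (z x)), ?_, ?_, ?_⟩, ?_⟩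
  · intro x y h
    have h1 : q x = q y := dC _ _ (by simpa using congrArg q h)
    refine hE x y h1 (dB _ _ (hi ?_))
    rw [map_add, map_add, hz, hz, h1]
    calc x - r (q y) + (x - r (q y)) = (x + x) - (r (q y) + r (q y)) := by abel
      _ = _ := by rw [h]; abel
  · intro x y h
    have h1 : q x = q y := hφ1 _ _ (by simpa [hr, hq] using congrArg q h)
    refine hE x y h1 (hθ1 _ _ (hi ?_))
    simpa [h1] using h
  · intro x y h
    have h1 : q x = q y := hφ2 _ _ (by simpa [hr, hq] using congrArg q h)
    refine hE x y h1 (hθ2 _ _ (hi ?_))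
    simp only [h1] at h
    rw [map_add, map_add, hz, hz, h1]
    apply add_left_cancel (a := r (θC (q y)) + r (q y))
    convert h using 1 <;> abel
  · intro x y h
    have h1 : q x = q y := hφ3 _ _ (by simpa [hr, hq] using congrArg q h)
    refine hE x y h1 (hθ3 _ _ (hi ?_))
    simp only [h1] at h
    rw [map_add, map_add, map_add, map_add, hz, hz, h1]
    apply add_left_cancel (a := r (θC (q y)) + r (θC (q y)) + r (q y))
    convert h using 1 <;> abel
  · set g : C → B → B := fun c b => if c = 0 then πB b else b with hg
    have hg1 : ∀ c a b, g c a = g c b → a = b := by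
      intro c a b h
      by_cases hc : c = 0
      · simp only [hg, hc, if_true] at h; exact hπ1 _ _ h
      · simpa only [hg, hc, if_false] using h
    have hg2 : ∀ c a b, a + g c a = b + g c b → a = b := by
      intro c a b h
      by_cases hc : c = 0
      · simp only [hg, hc, if_true] at h; exact hπ2 _ _ h
      · simp only [hg, hc, if_false] at h; exact dB _ _ h
    refine ⟨fun x => r (πC (q x)) + i (g (q x) (z x)), ?_, ?_, ?_⟩
    · intro x y h
      have h1 : q x = q y := hρ1 _ _ (by simpa [hr, hq] using congrArg q h)
      refine hE x y h1 (hg1 (q y) _ _ (hi ?_))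
      simpa [h1] using h
    · intro x y h
      have h1 : q x = q y := hρ2 _ _ (by simpa [hr, hq] using congrArg q h)
      refine hE x y h1 (hg2 (q y) _ _ (hi ?_))
      simp only [h1] at h
      rw [map_add, map_add, hz, hz, h1]
      apply add_left_cancel (a := r (πC (q y)) + r (q y))
      convert h using 1 <;> abel
    · intro b
      obtain ⟨κ0, h01, h02⟩ := hκC (πC 0)
      obtain ⟨κb, hb1, hb2⟩ := hκC (q b)
      obtain ⟨κ, hk1, hk2⟩ := hκB (z b)
      refine ⟨fun x => xor (if z x = z b then xor (κb (q x)) (xor (κb 0) (κ0 0)) else κ0 (q x))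
        (κ (z x)), ?_⟩
      have key : ∀ x, (r (πC (q x)) + i (g (q x) (z x)) = b ↔
          πC (q x) = q b ∧ g (q x) (z x) = z b) := by
        intro x
        constructor
        · rintro h
          constructor
          · rw [← h, hqr]
          · rw [← h, hzr]
        · rintro ⟨h1, h2⟩
          apply hE
          · rw [hqr, h1]
          · rw [hzr, h2]
      simp only [hqr, hzr]
      have e0 := h01 0 rfl
      have hinj0 : ∀ c, c ≠ 0 → κ0 (πC c) = !κ0 c := fun c hc => h02 c (fun h => hc (hρ1 _ _ h))
      constructor
      · intro x hxb
        obtain ⟨h1, h2⟩ := (key x).1 hxb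
        by_cases hc : q x = 0
        · simp only [hg, hc, if_true] at h1 h2 ⊢
          have := hb1 _ h1
          have h4 := hk1 _ h2
          rw [h2] at h4
          simp only [h2, if_true, this, h4]
          split_ifs <;> cases κb 0 <;> cases κ0 0 <;> cases κ (z x) <;> rfl
        · simp only [hg, hc, if_false] at h1 h2 ⊢
          have := hb1 _ h1
          simp only [h2, if_true, this]
      · intro x hxb
        have hk : ¬ (πC (q x) = q b ∧ g (q x) (z x) = z b) := fun h => hxb ((key x).2 h)
        by_cases hc : q x = 0
        · simp only [hg, hc, if_true] at hk ⊢
          by_cases h2 : πB (z x) = z b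
          · have h1 : πC 0 ≠ q b := fun h => hk ⟨h, h2⟩
            have h4 := hk1 _ h2
            rw [h2] at h4
            simp only [h2, if_true, hb2 _ h1, h4]
            split_ifs <;> cases κb 0 <;> cases κ0 0 <;> cases κ (z x) <;> rfl
          · have h4 := hk2 _ h2
            simp only [h2, if_false, e0, h4]
            split_ifs <;> cases κb 0 <;> cases κ0 0 <;> cases κ (z x) <;> rfl
        · simp only [hg, hc, if_false] at hk ⊢
          by_cases h2 : z x = z b
          · have h1 : πC (q x) ≠ q b := fun h => hk ⟨h, h2⟩
            simp only [h2, if_true, hb2 _ h1]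
            cases κb (q x) <;> simp
          · simp only [h2, if_false, hinj0 _ hc]
            cases κ0 (q x) <;> simp

lemma TGood.of_subsingleton {X : Type*} [AddCommGroup X] [Subsingleton X] : TGood X := by
  refine ⟨fun x y _ => Subsingleton.elim _ _, ⟨id, ?_, ?_, ?_⟩, id, ?_, ?_, ?_⟩
  any_goals exact fun x y _ => Subsingleton.elim _ _
  exact fun b => ⟨fun _ => true, fun _ _ => rfl, fun x h => (h (Subsingleton.elim _ _)).elim⟩

lemma TGood.zmod (p : ℕ) (hp : p.Prime) (h5 : 5 ≤ p) : TGood (ZMod p) := by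
  have := Fact.mk hp
  have h2 : (2 : ZMod p) ≠ 0 := by
    intro h
    have := (ZMod.natCast_eq_zero_iff 2 p).1 (by exact_mod_cast h)
    have := Nat.le_of_dvd (by norm_num) this
    omega
  have h3 : (3 : ZMod p) ≠ 0 := by
    intro h
    have := (ZMod.natCast_eq_zero_iff 3 p).1 (by exact_mod_cast h)
    have := Nat.le_of_dvd (by norm_num) this
    omega
  have hd : ∀ x y : ZMod p, x + x = y + y → x = y := by
    intro x y h
    apply mul_left_cancel₀ h2; linear_combination h
  refine ⟨hd, ⟨id, fun x y h => h, hd, ?_⟩, fun x => x + 1, ?_, ?_, ?_⟩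
  · intro x y h
    simp only [id] at h
    apply mul_left_cancel₀ h3; linear_combination h
  · intro x y h; exact add_right_cancel h
  · intro x y h
    apply hd; linear_combination h
  · have hodd : p % 2 = 1 := by
      rcases hp.eq_two_or_odd with h | h <;> omega
    intro b
    refine ⟨fun x => decide ((x - b).val % 2 = 1), ?_, ?_⟩
    · intro x h
      have h1 : x - b = -1 := by linear_combination h
      have h2' : x + 1 - b = 0 := by linear_combination h
      obtain ⟨m, rfl⟩ : ∃ m, p = m + 1 := ⟨p - 1, by omega⟩
      beta_reduce
      rw [h1, h2', ZMod.val_neg_one]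
      simp; omega
    · intro x h
      have e : x + 1 - b = (x - b) + 1 := by ring
      have h1 : x - b + 1 ≠ 0 := by
        intro h'; apply h; linear_combination h'
      beta_reduce
      rw [e]
      have hv : (x - b + 1).val = (x - b).val + 1 := by
        rw [ZMod.val_add_of_lt] <;> rw [ZMod.val_one]
        have hlt := ZMod.val_lt (x - b)
        by_contra hcon
        have h6 : (x-b).val + 1 = p := by omega
        apply h1
        rw [← ZMod.natCast_zmod_val (x - b)]
        have : (((x-b).val + 1 : ℕ) : ZMod p) = 0 := by rw [h6]; simp
        exact_mod_cast this
      rw [hv]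
      by_cases h7 : (x-b).val % 2 = 1
      · simp [h7]; omega
      · simp [h7]; omega

lemma TGood.z33 : TGood (ZMod 3 × ZMod 3) := by
  refine ⟨by decide, ⟨fun x => (-x.2, x.1), by decide, by decide, by decide⟩,
    fun x => (x.1 + 1, if x.1 = 2 then x.2 + 1 else x.2), by decide, by decide, ?_⟩
  intro b
  refine ⟨fun x => decide (((x.1.val + 3 * x.2.val + 9 - (b.1.val + 3 * b.2.val)) % 9) % 2 = 1), ?_⟩
  revert b
  decide

/-- solution for cyclic groups -/
lemma cyc_obj (N : ℕ) (hN : 0 < N) : ∃ (s : Fin N → Bool) (α : Fin N → ZMod (2 * N)),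
    let δ : Fin N → ZMod (2 * N) := fun j => 2 * (j.val : ZMod (2*N)) + (if s j then 1 else 0)
    (∀ j k, α j = α k → j = k) ∧ (∀ j k, α j + δ j = α k + δ k → j = k) ∧
    (∀ j k, α j + (α j + δ j) = α k + (α k + δ k) → j = k) := by
  obtain ⟨e, he1, he⟩ : ∃ e : ℕ, e ≤ 1 ∧ (1 + e + N) % 3 ≠ 0 := by
    by_cases h : N % 3 = 2
    · exact ⟨1, by omega, by omega⟩
    · exact ⟨0, by omega, by omega⟩
  have hmod : ∀ a b : ℕ, (a : ZMod (2*N)) = b → b < 4 * N → a < 4 * N →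
      a = b ∨ a = b + 2 * N ∨ b = a + 2 * N := by
    intro a b h ha hb
    rw [ZMod.natCast_eq_natCast_iff] at h
    have hz := (Nat.modEq_iff_dvd.1 h)
    obtain ⟨k, hk⟩ := hz
    have h1 : k < 2 := by
      by_contra hc
      have : (2 * N : ℤ) * 2 ≤ 2 * N * k := by apply mul_le_mul_of_nonneg_left <;> omega
      push_cast at hk
      omega
    have h2 : -2 < k := by
      by_contra hc
      have : (2 * N : ℤ) * k ≤ 2 * N * (-2) := by apply mul_le_mul_of_nonneg_left <;> omega
      push_cast at hk
      omega
    have : k = -1 ∨ k = 0 ∨ k = 1 := by omega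
    push_cast at hk
    rcases this with rfl | rfl | rfl <;> omega
  have hpar : ∀ a b : ℕ, (a : ZMod (2*N)) = b → a % 2 = b % 2 := by
    intro a b h
    rw [ZMod.natCast_eq_natCast_iff] at h
    exact Nat.ModEq.of_mul_right N h
  have hdbl : ∀ a b : ℕ, ((2 * a : ℕ) : ZMod (2*N)) = (2 * b : ℕ) → a ≡ b [MOD N] := by
    intro a b h
    rw [ZMod.natCast_eq_natCast_iff] at h
    exact Nat.ModEq.mul_left_cancel' (by norm_num) h
  have hN2 : ∀ a b : ℕ, a ≡ b [MOD N] → a < b + N → b < a + N → a = b := by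
    intro a b h h1 h2
    rw [Nat.modEq_iff_dvd] at h
    have := Int.eq_zero_of_abs_lt_dvd h (by rw [abs_lt]; omega)
    omega
  refine ⟨fun j => decide (N ≤ 2 * j.val),
    fun j => ((if N ≤ 2 * j.val then j.val + e else j.val : ℕ) : ZMod (2 * N)), ?_⟩
  intro δ
  have hδ : ∀ j : Fin N, δ j = ((if N ≤ 2 * j.val then 2 * j.val + 1 else 2 * j.val : ℕ) : ZMod (2 * N)) := by
    intro j
    simp only [δ, decide_eq_true_eq]
    split_ifs <;> push_cast <;> ring
  simp only [hδ, ← Nat.cast_add]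
  refine ⟨?_, ?_, ?_⟩
  · intro j k h
    have h1 := j.2
    have h2 := k.2
    ext
    have := hmod _ _ h (by split_ifs <;> omega) (by split_ifs <;> omega)
    split_ifs at this <;> omega
  · intro j k h
    have h1 := j.2
    have h2 := k.2
    ext
    have := hmod _ _ h (by split_ifs <;> omega) (by split_ifs <;> omega)
    split_ifs at this <;> omega
  · intro j k h
    have h1 := j.2
    have h2 := k.2
    ext
    have hp := hpar _ _ h
    have hd : (2 * j.val) ≡ (2 * k.val) [MOD N] := by
      split_ifs at h hp with ha hb hb
      · apply hdbl
        have : ((j.val + e + (j.val + e + (2 * j.val + 1)) : ℕ) : ZMod (2*N)) = 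
          (2 * (2 * j.val) : ℕ) + (2 * e + 1 : ℕ) := by push_cast; ring
        rw [this] at h
        have : ((k.val + e + (k.val + e + (2 * k.val + 1)) : ℕ) : ZMod (2*N)) = 
          (2 * (2 * k.val) : ℕ) + (2 * e + 1 : ℕ) := by push_cast; ring
        rw [this] at h
        exact add_right_cancel h
      · omega
      · omega
      · apply hdbl
        convert h using 2 <;> ring
    have := hN2 _ _ hd
    split_ifs at hp <;> omega

section half
variable {N : ℕ}

lemma val_N (hN : 0 < N) : ((N : ZMod (2 * N))).val = N := by
  rw [ZMod.val_natCast, Nat.mod_eq_of_lt (by omega)]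

lemma NN : (N : ZMod (2 * N)) + N = 0 := by
  have : ((2 * N : ℕ) : ZMod (2 * N)) = 0 := ZMod.natCast_self _
  push_cast at this
  linear_combination this

lemma half_add (hN : 0 < N) (u : ZMod (2 * N)) : N ≤ (u + N).val ↔ ¬ N ≤ u.val := by
  have : NeZero (2 * N) := ⟨by omega⟩
  have hu := ZMod.val_lt u
  rw [ZMod.val_add, val_N hN]
  by_cases h : u.val + N < 2 * N
  · rw [Nat.mod_eq_of_lt h]; omega
  · rw [Nat.mod_eq_sub_mod (by omega), Nat.mod_eq_of_lt (by omega)]; omega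

lemma half_succ (hN : 0 < N) (u : ZMod (2 * N)) :
    ((u + 1 = 0 ∨ u + 1 = N) ∧ (N ≤ (u + 1).val ↔ ¬ N ≤ u.val)) ∨
    (¬ (u + 1 = 0 ∨ u + 1 = N) ∧ (N ≤ (u + 1).val ↔ N ≤ u.val)) := by
  have : NeZero (2 * N) := ⟨by omega⟩
  have : Fact (1 < 2 * N) := ⟨by omega⟩
  have hu := ZMod.val_lt u
  have e : (u + 1).val = (u.val + 1) % (2 * N) := by rw [ZMod.val_add, ZMod.val_one]
  have e0 : u + 1 = 0 ↔ (u + 1).val = 0 := (ZMod.val_eq_zero _).symm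
  have eN : u + 1 = N ↔ (u + 1).val = N := by
    constructor
    · intro h; rw [h, val_N hN]
    · intro h; apply ZMod.val_injective; rw [h, val_N hN]
  rw [e0, eN, e]
  by_cases h : u.val + 1 < 2 * N
  · rw [Nat.mod_eq_of_lt h]; omega
  · have : u.val + 1 = 2 * N := by omega
    rw [this, Nat.mod_self]; omega

lemma dbl_eq (hN : 0 < N) (i k : ZMod (2 * N)) (h : i + i = k + k) : i = k ∨ i = k + N := by
  have : NeZero (2 * N) := ⟨by omega⟩
  obtain ⟨w, rfl⟩ : ∃ w, i = k + w := ⟨i - k, by ring⟩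
  have hw : w + w = 0 := by linear_combination h
  have hlt := ZMod.val_lt w
  have hv : (w + w).val = 0 := by rw [hw, ZMod.val_zero]
  rw [ZMod.val_add] at hv
  by_cases h1 : w.val + w.val < 2 * N
  · rw [Nat.mod_eq_of_lt h1] at hv
    left
    rw [(ZMod.val_eq_zero w).1 (by omega), add_zero]
  · rw [Nat.mod_eq_sub_mod (by omega), Nat.mod_eq_of_lt (by omega)] at hv
    right
    congr 1
    apply ZMod.val_injective
    rw [val_N hN]; omega

lemma dbl_ne (w : ZMod (2 * N)) : w + w ≠ 1 := by
  intro h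
  have := congrArg (ZMod.castHom (Dvd.intro N rfl : 2 ∣ 2 * N) (ZMod 2)) h
  rw [map_add, map_one] at this
  revert this
  generalize (ZMod.castHom (Dvd.intro N rfl : 2 ∣ 2 * N) (ZMod 2)) w = v
  revert v
  decide

lemma exists_section {G : Type*} [AddCommGroup G] (hN : 0 < N) (f : G →+ ZMod (2 * N))
    (hf : Function.Surjective f) (t : G) (ht : t + t = 0) (hft : f t = N) :
    ∃ σ : ZMod (2 * N) → G, (∀ k, f (σ k) = k) ∧ ∀ k, σ (k + N) = σ k + t := by
  choose r hr using hf
  refine ⟨fun k => if N ≤ k.val then r (k - N) + t else r k, ?_, ?_⟩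
  · intro k
    beta_reduce
    split_ifs
    · simp [hr, hft]
    · exact hr k
  · intro k
    beta_reduce
    have h := half_add hN k
    by_cases hk : N ≤ k.val
    · rw [if_neg (by tauto), if_pos hk, add_assoc, ht, add_zero]
      congr 1
      linear_combination NN (N := N)
    · rw [if_pos (by tauto), if_neg hk, add_sub_cancel_right]

end half

open Classical in
lemma main_color {G : Type*} [AddCommGroup G] {N : ℕ} (hN : 0 < N) (f : G →+ ZMod (2 * N))
    (hf : Function.Surjective f) (t : G) (ht : t + t = 0) (hft : f t = N) (hg : TGood f.ker) :
    ∃ col : G × G → (Fin N × f.ker × Bool) ⊕ Bool, ∀ p q, col p = col q →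
      (p.1 = q.1 ∨ p.2 = q.2 ∨ p.1 + p.2 = q.1 + q.2) → p = q := by
  have : NeZero (2 * N) := ⟨by omega⟩
  obtain ⟨σ, hσ, hσN⟩ := exists_section hN f hf t ht hft
  obtain ⟨s, α, hα1, hα2, hα3⟩ := cyc_obj N hN
  set δ : Fin N → ZMod (2 * N) := fun j => 2 * (j.val : ZMod (2*N)) + (if s j then 1 else 0) with hδ
  obtain ⟨dA, ⟨θ, hθ1, hθ2, hθ3⟩, π, hπ1, hπ2, hκ⟩ := hg
  choose κ hκ1 hκ2 using hκ
  let η : Fin N → ZMod (2 * N) := fun j => if s j then -1 else 1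
  have hη : ∀ j, η j = 1 ∨ η j = -1 := by intro j; simp only [η]; split_ifs <;> simp
  have hηη : ∀ j, η j * η j = 1 := by intro j; rcases hη j with h | h <;> rw [h] <;> ring
  have hηN : ∀ j, N * η j = N := by
    intro j
    rcases hη j with h | h <;> rw [h]
    · ring
    · linear_combination -NN (N := N)
  obtain ⟨ξ, hξ⟩ : ∃ ξ : G → f.ker, ∀ a, a = σ (f a) + ξ a := by
    refine ⟨fun a => ⟨a - σ (f a), ?_⟩, ?_⟩
    · rw [AddMonoidHom.mem_ker, map_sub, hσ, sub_self]
    · intro a; simp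
  have hfk : ∀ x : f.ker, f x = 0 := fun x => x.2
  let U : Fin N → ZMod (2 * N) → ZMod (2 * N) := fun j i => (i - α j) * η j
  let Sp : ZMod (2 * N) → Prop := fun u => u + 1 = 0 ∨ u + 1 = N
  let Pt : Fin N → ZMod (2 * N) → f.ker → f.ker := fun j i x => if Sp (U j i) then π x else x
  have hPt1 : ∀ j i x y, Pt j i x = Pt j i y → x = y := by
    intro j i x y h
    simp only [Pt] at h
    split_ifs at h
    · exact hπ1 _ _ h
    · exact h
  have hPt2 : ∀ j i x y, x + Pt j i x = y + Pt j i y → x = y := by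
    intro j i x y h
    simp only [Pt] at h
    split_ifs at h
    · exact hπ2 _ _ h
    · exact dA _ _ h
  have hUN : ∀ j i, U j (i + N) = U j i + N := by
    intro j i
    simp only [U]
    linear_combination hηN j
  have hUη : ∀ j i, U j (i + η j) = U j i + 1 := by
    intro j i
    simp only [U]
    linear_combination hηη j
  have hSpN : ∀ u, Sp (u + N) ↔ Sp u := by
    intro u
    have e1 : u + N + 1 = 0 ↔ u + 1 = N := by
      constructor
      · intro h; linear_combination h - NN (N := N)
      · intro h; linear_combination h + NN (N := N)
    have e2 : u + N + 1 = N ↔ u + 1 = 0 := by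
      constructor
      · intro h; linear_combination h
      · intro h; linear_combination h
    simp only [Sp, e1, e2]; tauto
  have hPtN : ∀ j i x, Pt j (i + N) x = Pt j i x := by
    intro j i x
    simp only [Pt, hUN, hSpN]
  -- the index and type of a cell
  have hJ : ∀ p : G × G, ∃ j : Fin N, ∃ m : Bool,
      f p.2 = f p.1 + δ j + (if m then 0 else η j) := by
    intro p
    have hlt := ZMod.val_lt (f p.2 - f p.1)
    have hc : ((2 * ((f p.2 - f p.1).val / 2) + (f p.2 - f p.1).val % 2 : ℕ) : ZMod (2*N)) = f p.2 - f p.1 := by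
      rw [Nat.div_add_mod, ZMod.natCast_zmod_val]
    refine ⟨⟨(f p.2 - f p.1).val / 2, by omega⟩, ?_⟩
    rcases Nat.mod_two_eq_zero_or_one (f p.2 - f p.1).val with h | h <;> rw [h] at hc <;>
      push_cast at hc
    · cases hs : s ⟨(f p.2 - f p.1).val / 2, by omega⟩
      · refine ⟨true, ?_⟩
        simp only [hδ, hs]
        simp; linear_combination -hc
      · refine ⟨false, ?_⟩
        simp only [hδ, hs, η]
        simp; linear_combination -hc
    · cases hs : s ⟨(f p.2 - f p.1).val / 2, by omega⟩
      · refine ⟨false, ?_⟩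
        simp only [hδ, hs, η]
        simp; linear_combination -hc
      · refine ⟨true, ?_⟩
        simp only [hδ, hs]
        simp; linear_combination -hc
  choose J m hJm using hJ
  let H : G × G → f.ker := fun p => if m p then ξ p.2 - ξ p.1 else ξ p.2 - Pt (J p) (f p.1) (ξ p.1)
  let R : G × G → Prop := fun p => m p = true ∧ ξ p.1 = θ (H p) ∧
    (U (J p) (f p.1) = 0 ∨ U (J p) (f p.1) = N)
  let F : G × G → Bool := fun p => xor (κ (θ (H p)) (ξ p.1)) (decide (N ≤ (U (J p) (f p.1)).val))
  -- second coordinates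
  have hm2 : ∀ p, m p = true → f p.2 = f p.1 + δ (J p) ∧ ξ p.2 = ξ p.1 + H p := by
    intro p hp
    constructor
    · have := hJm p; rw [hp] at this; simpa using this
    · simp [H, hp]
  have ho2 : ∀ p, m p = false → f p.2 = f p.1 + δ (J p) + η (J p) ∧
      ξ p.2 = Pt (J p) (f p.1) (ξ p.1) + H p := by
    intro p hp
    constructor
    · have := hJm p; rw [hp] at this; simpa using this
    · simp [H, hp]
  have hsame : ∀ p q, J p = J q → H p = H q → m p = m q → f p.1 = f q.1 → ξ p.1 = ξ q.1 → p = q := by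
    intro p q h1 h2 h3 h4 h5
    have e1 : p.1 = q.1 := by rw [hξ p.1, hξ q.1, h4, h5]
    have e2 : p.2 = q.2 := by
      cases hq : m q
      · have a := ho2 p (h3.trans hq)
        have b := ho2 q hq
        rw [hξ p.2, hξ q.2, a.1, a.2, b.1, b.2, h1, h2, h4, h5]
      · have a := hm2 p (h3.trans hq)
        have b := hm2 q hq
        rw [hξ p.2, hξ q.2, a.1, a.2, b.1, b.2, h1, h2, h4, h5]
    exact Prod.ext e1 e2
  have hsum : ∀ p q : G × G, p.1 + p.2 = q.1 + q.2 → f p.1 + f p.2 = f q.1 + f q.2 ∧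
      ((σ (f p.1) + σ (f p.2) = σ (f q.1) + σ (f q.2)) → ξ p.1 + ξ p.2 = ξ q.1 + ξ q.2) := by
    intro p q h
    refine ⟨by rw [← map_add, h, map_add], fun h2 => ?_⟩
    apply Subtype.ext
    have k : ∀ a, (ξ a : G) = a - σ (f a) := fun a => eq_sub_of_add_eq' (hξ a).symm
    push_cast
    rw [k, k, k, k, sub_add_sub_comm, sub_add_sub_comm, h2, h]
  have hFN : ∀ p q, J p = J q → H p = H q → f p.1 = f q.1 + N → ξ p.1 = ξ q.1 → F p ≠ F q := by
    intro p q h1 h2 h3 h4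
    simp only [F, h1, h2, h3, h4, hUN]
    have := half_add hN (U (J q) (f q.1))
    by_cases hh : N ≤ (U (J q) (f q.1)).val <;> simp [this, hh]
  -- same type, same ladder
  have hst : ∀ p q, J p = J q → H p = H q → m p = m q → F p = F q →
      (p.1 = q.1 ∨ p.2 = q.2 ∨ p.1 + p.2 = q.1 + q.2) → p = q := by
    intro p q h1 h2 h3 h4 h5
    rcases h5 with h5 | h5 | h5
    · exact hsame p q h1 h2 h3 (by rw [h5]) (by rw [h5])
    · cases hq : m q
      · have a := ho2 p (h3.trans hq)
        have b := ho2 q hq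
        rw [h5, h1] at a
        have e1 : f p.1 = f q.1 := by
          linear_combination b.1 - a.1
        refine hsame p q h1 h2 h3 e1 ?_
        rw [e1] at a
        have := a.2.symm.trans b.2
        rw [h2] at this
        exact hPt1 _ _ _ _ (add_right_cancel this)
      · have a := hm2 p (h3.trans hq)
        have b := hm2 q hq
        rw [h5, h1] at a
        have e1 : f p.1 = f q.1 := by
          linear_combination b.1 - a.1
        refine hsame p q h1 h2 h3 e1 ?_
        have := a.2.symm.trans b.2
        rw [h2] at this
        exact (add_right_cancel this)
    · obtain ⟨g1, g2⟩ := hsum p q h5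
      have e2 : ∃ c, f p.2 = f p.1 + c ∧ f q.2 = f q.1 + c := by
        cases hq : m q
        · have a := ho2 p (h3.trans hq)
          have b := ho2 q hq
          exact ⟨δ (J q) + η (J q), by rw [a.1, h1, add_assoc], by rw [b.1, add_assoc]⟩
        · have a := hm2 p (h3.trans hq)
          have b := hm2 q hq
          exact ⟨δ (J q), by rw [a.1, h1], by rw [b.1]⟩
      obtain ⟨c, c1, c2⟩ := e2
      have e3 := dbl_eq hN (f p.1) (f q.1) (by linear_combination g1 - c1 + c2)
      have e4 : σ (f p.1) + σ (f p.2) = σ (f q.1) + σ (f q.2) := by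
        rw [c1, c2]
        rcases e3 with e3 | e3
        · rw [e3]
        · rw [e3, add_right_comm, hσN, hσN, add_add_add_comm, ht, add_zero]
      have e5 := g2 e4
      have e6 : ξ p.1 = ξ q.1 := by
        cases hq : m q
        · have a := ho2 p (h3.trans hq)
          have b := ho2 q hq
          have ePt : Pt (J p) (f p.1) (ξ p.1) = Pt (J q) (f q.1) (ξ p.1) := by
            rcases e3 with e3 | e3 <;> rw [e3, h1]
            rw [hPtN]
          rw [a.2, b.2, ePt, h2, ← add_assoc, ← add_assoc] at e5
          exact hPt2 _ _ _ _ (add_right_cancel e5)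
        · have a := hm2 p (h3.trans hq)
          have b := hm2 q hq
          rw [a.2, b.2, h2, ← add_assoc, ← add_assoc] at e5
          exact dA _ _ (add_right_cancel e5)
      rcases e3 with e3 | e3
      · exact hsame p q h1 h2 h3 e3 e6
      · exact (hFN p q h1 h2 e3 e6 h4).elim
  -- different type, same ladder
  have hdt : ∀ p q, J p = J q → H p = H q → m p = true → m q = false → F p = !F q → ¬ R p →
      (p.1 = q.1 ∨ p.2 = q.2 ∨ p.1 + p.2 = q.1 + q.2) → False := by
    intro p q h1 h2 hp hq h4 hR h5
    have a := hm2 p hp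
    have b := ho2 q hq
    rcases h5 with h5 | h5 | h5
    · simp only [F, h1, h2, h5] at h4
      revert h4
      cases xor (κ (θ (H q)) (ξ q.1)) (decide (N ≤ (U (J q) (f q.1)).val)) <;> simp
    · rw [h5, h1] at a
      have e1 : f p.1 = f q.1 + η (J q) := by linear_combination b.1 - a.1
      have e2 : ξ p.1 = Pt (J q) (f q.1) (ξ q.1) := by
        have := a.2.symm.trans b.2
        rw [h2] at this
        exact (add_right_cancel this)
      have hu : U (J p) (f p.1) = U (J q) (f q.1) + 1 := by rw [h1, e1, hUη]
      simp only [R, not_and] at hR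
      have hR := hR hp
      rw [hu] at hR
      simp only [F] at h4
      rw [hu] at h4
      simp only [h2, e2, Pt] at h4 hR
      rcases half_succ hN (U (J q) (f q.1)) with ⟨c1, c2⟩ | ⟨c1, c2⟩
      · rw [if_pos c1] at h4 hR
        have c3 : π (ξ q.1) ≠ θ (H q) := fun h => hR h c1
        rw [hκ2 _ _ c3] at h4
        by_cases hh : N ≤ (U (J q) (f q.1)).val <;> simp [c2, hh] at h4
      · rw [if_neg c1] at h4
        by_cases hh : N ≤ (U (J q) (f q.1)).val <;> simp [c2, hh] at h4
    · obtain ⟨g1, -⟩ := hsum p q h5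
      rw [a.1, b.1, h1] at g1
      have : (f p.1 - f q.1) + (f p.1 - f q.1) = η (J q) := by linear_combination g1
      rcases hη (J q) with h | h <;> rw [h] at this
      · exact dbl_ne _ this
      · exact dbl_ne (-(f p.1 - f q.1)) (by linear_combination -this)
  -- removed cells
  have hrm : ∀ p q, R p → R q → (U (J p) (f p.1) = 0 ↔ U (J q) (f q.1) = 0) →
      (p.1 = q.1 ∨ p.2 = q.2 ∨ p.1 + p.2 = q.1 + q.2) → p = q := by
    intro p q hp hq h h5
    obtain ⟨hp1, hp2, hp3⟩ := hp
    obtain ⟨hq1, hq2, hq3⟩ := hq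
    obtain ⟨c, hc, c1, c2⟩ : ∃ c : ZMod (2 * N), (c = 0 ∨ c = N) ∧ U (J p) (f p.1) = c ∧ U (J q) (f q.1) = c := by
      by_cases h0 : U (J p) (f p.1) = 0
      · exact ⟨0, Or.inl rfl, h0, h.1 h0⟩
      · exact ⟨N, Or.inr rfl, hp3.resolve_left h0, hq3.resolve_left (fun h' => h0 (h.2 h'))⟩
    have hinv : ∀ p : G × G, U (J p) (f p.1) = c → f p.1 = α (J p) + c := by
      intro p hp
      have h1 : c * η (J p) = c := by
        rcases hc with rfl | rfl
        · ring
        · exact hηN _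
      simp only [U] at hp
      linear_combination η (J p) * hp - (f p.1 - α (J p)) * hηη (J p) + h1
    have i1 := hinv p c1
    have i2 := hinv q c2
    have a := hm2 p hp1
    have b := hm2 q hq1
    have fin : J p = J q → (J p = J q → H p = H q) → p = q := by
      intro hj hh
      have hh := hh hj
      exact hsame p q hj hh (hp1.trans hq1.symm) (by rw [i1, i2, hj]) (by rw [hp2, hq2, hh])
    rcases h5 with h5 | h5 | h5
    · apply fin
      · apply hα1; rw [h5] at i1; exact add_right_cancel (i1.symm.trans i2)
      · intro _
        apply hθ1; rw [← hp2, ← hq2, h5]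
    · apply fin
      · apply hα2
        have := a.1
        rw [h5, b.1] at this
        linear_combination i2 - i1 - this
      · intro _
        apply hθ2; rw [← hp2, ← hq2, ← a.2, ← b.2, h5]
    · obtain ⟨g1, g2⟩ := hsum p q h5
      apply fin
      · apply hα3
        rw [a.1, b.1] at g1
        linear_combination g1 - 2 * i1 + 2 * i2
      · intro hj
        apply hθ3
        have e1 : f p.1 = f q.1 := by rw [i1, i2, hj]
        have e2 := g2 (by rw [a.1, b.1, e1, hj])
        rw [← hp2, ← hq2, ← a.2, ← b.2, e2]
  refine ⟨fun p => if R p then Sum.inr (decide (U (J p) (f p.1) = 0)) else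
    Sum.inl (J p, H p, xor (F p) (m p)), ?_⟩
  intro p q h h5
  by_cases hp : R p <;> by_cases hq : R q <;> simp only [hp, hq, if_true, if_false] at h
  · simp only [Sum.inr.injEq, decide_eq_decide] at h
    exact hrm p q hp hq h h5
  · cases h
  · cases h
  · simp only [Sum.inl.injEq, Prod.mk.injEq] at h
    obtain ⟨h1, h2, h3⟩ := h
    cases hmp : m p <;> cases hmq : m q <;> rw [hmp, hmq] at h3
    · exact hst p q h1 h2 (hmp.trans hmq.symm) (by simpa using h3) h5
    · refine (hdt q p h1.symm h2.symm hmq hmp (by simpa using h3.symm) hq ?_).elim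
      rcases h5 with h | h | h
      · exact Or.inl h.symm
      · exact Or.inr (Or.inl h.symm)
      · exact Or.inr (Or.inr h.symm)
    · exact (hdt p q h1 h2 hmp hmq (by simpa using h3) hp h5).elim
    · exact hst p q h1 h2 (hmp.trans hmq.symm) (by simpa using h3) h5

universe u

open Classical in
lemma cyc_crit (G : Type*) [AddCommGroup G] [Fintype G]
    (h : ∀ p : ℕ, p.Prime → (Finset.univ.filter (fun x : G => p • x = 0)).card ≤ p) :
    IsAddCyclic G := by
  apply isAddCyclic_of_card_nsmul_eq_zero_le
  intro n
  induction n using Nat.recOnMul with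
  | zero => intro h; exact absurd h (lt_irrefl 0)
  | one =>
    intro _
    rw [Finset.card_le_one]
    intro a ha b hb
    simp at ha hb
    rw [ha, hb]
  | prime p hp => intro _; exact h p hp
  | mul a b iha ihb =>
    intro hab
    have ha : 0 < a := Nat.pos_of_mul_pos_right hab
    have hb : 0 < b := Nat.pos_of_mul_pos_left hab
    have iha := iha ha
    have ihb := ihb hb
    refine (Finset.card_le_mul_card_image (f := fun x : G => a • x) _ a ?_).trans
      (Nat.mul_le_mul_left a ((Finset.card_le_card ?_).trans ihb))
    · intro y hy
      obtain ⟨x0, hx0, rfl⟩ := Finset.mem_image.1 hy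
      refine le_trans ?_ iha
      apply Finset.card_le_card_of_injOn (fun x => x - x0)
      · intro x hx
        simp only [Finset.coe_filter, Finset.mem_filter, Finset.mem_univ, true_and, Set.mem_ofPred_eq] at hx ⊢
        rw [nsmul_sub, hx.2, sub_self]
      · intro x _ y _ hxy
        exact sub_left_injective hxy
    · intro y hy
      obtain ⟨x0, hx0, rfl⟩ := Finset.mem_image.1 hy
      simp only [Finset.mem_filter, Finset.mem_univ, true_and] at hx0 ⊢
      rw [smul_smul, mul_comm b a, hx0]

def Concl (G : Type*) [AddCommGroup G] (t : G) : Prop :=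
  ∃ N : ℕ, 0 < N ∧ ∃ f : G →+ ZMod (2 * N), Function.Surjective f ∧ f t = N ∧ TGood f.ker

def Uniq {G : Type*} [AddCommGroup G] (t : G) : Prop :=
  t ≠ 0 ∧ t + t = 0 ∧ ∀ x : G, x + x = 0 → x = 0 ∨ x = t

lemma Concl.of_cyclic {G : Type*} [AddCommGroup G] [Finite G] (t : G) (ht : Uniq t)
    (hG : IsAddCyclic G) : Concl G t := by
  obtain ⟨h0, h2, -⟩ := ht
  have h3 : addOrderOf t = 2 := addOrderOf_eq_prime (by rw [two_nsmul, h2]) h0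
  have hd : 2 ∣ Nat.card G := h3 ▸ addOrderOf_dvd_natCard t
  obtain ⟨N, hN⟩ := hd
  have hpos : 0 < N := by
    have := Nat.card_pos (α := G)
    omega
  have e := (zmodAddCyclicAddEquiv hG).symm
  rw [hN] at e
  refine ⟨N, hpos, e.toAddMonoidHom, e.surjective, ?_, ?_⟩
  · have := dbl_eq hpos (e t) 0 (by rw [← map_add, h2]; simp)
    rcases this with h | h
    · exact absurd ((map_eq_zero_iff e e.injective).1 h) h0
    · simpa using h
  · have : Subsingleton e.toAddMonoidHom.ker := by
      constructor
      rintro ⟨x, hx⟩ ⟨y, hy⟩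
      apply Subtype.ext
      apply e.injective
      exact hx.trans hy.symm
    exact TGood.of_subsingleton

lemma Concl.step {G B : Type*} [AddCommGroup G] [AddCommGroup B] [Finite B]
    (t : G) (ht : Uniq t) (i : B →+ G) (hi : Function.Injective i) (hB : TGood B)
    (ih : ∀ t' : G ⧸ i.range, Uniq t' → Concl (G ⧸ i.range) t') : Concl G t := by
  obtain ⟨h0, h2, h3⟩ := ht
  have hdB := hB.1
  have hdS : Function.Surjective (fun x : B => x + x) :=
    Finite.surjective_of_injective (fun x y h => hdB x y h)
  have hU : Uniq (QuotientAddGroup.mk' i.range t) := by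
    refine ⟨?_, ?_, ?_⟩
    · intro h
      rw [QuotientAddGroup.mk'_apply, QuotientAddGroup.eq_zero_iff] at h
      obtain ⟨b, rfl⟩ := h
      apply h0
      have : b = 0 := hdB b 0 (hi (by rw [map_add, h2]; simp))
      rw [this, map_zero]
    · rw [← map_add, h2, map_zero]
    · intro x hx
      obtain ⟨x, rfl⟩ := QuotientAddGroup.mk'_surjective _ x
      rw [← map_add, QuotientAddGroup.mk'_apply, QuotientAddGroup.eq_zero_iff] at hx
      obtain ⟨b, hb⟩ := hx
      obtain ⟨c, rfl⟩ := hdS b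
      have hc : QuotientAddGroup.mk' i.range (i c) = 0 := by
        rw [QuotientAddGroup.mk'_apply, QuotientAddGroup.eq_zero_iff]; exact ⟨c, rfl⟩
      have : (x - i c) + (x - i c) = 0 := by
        rw [sub_add_sub_comm, ← hb, map_add, sub_self]
      rcases h3 _ this with h | h
      · left
        rw [sub_eq_zero.1 h, hc]
      · right
        rw [← h, map_sub, hc, sub_zero]
  obtain ⟨N, hN, f, hf, hft, hg⟩ := ih _ hU
  let Q := QuotientAddGroup.mk' i.range
  have hQ : Function.Surjective Q := QuotientAddGroup.mk'_surjective _
  have hQi : ∀ b, Q (i b) = 0 := by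
    intro b
    rw [QuotientAddGroup.mk'_apply, QuotientAddGroup.eq_zero_iff]; exact ⟨b, rfl⟩
  refine ⟨N, hN, f.comp Q, hf.comp hQ, hft, ?_⟩
  let i' : B →+ (f.comp Q).ker := i.codRestrict _ (fun b => by
    rw [AddMonoidHom.mem_ker, AddMonoidHom.comp_apply, hQi, map_zero])
  let q' : (f.comp Q).ker →+ f.ker := (Q.comp (f.comp Q).ker.subtype).codRestrict _ (fun x => x.2)
  have hq' : Function.Surjective q' := by
    rintro ⟨y, hy⟩
    obtain ⟨x, rfl⟩ := hQ y
    exact ⟨⟨x, hy⟩, rfl⟩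
  choose r hr using hq'
  have hz : ∀ x, ∃ b, i' b = x - r (q' x) := by
    intro x
    have : q' (x - r (q' x)) = 0 := by rw [map_sub, hr, sub_self]
    have h5 : Q ((x - r (q' x) : (f.comp Q).ker) : G) = 0 := congrArg Subtype.val this
    rw [QuotientAddGroup.mk'_apply, QuotientAddGroup.eq_zero_iff] at h5
    obtain ⟨b, hb⟩ := h5
    exact ⟨b, Subtype.ext hb⟩
  choose z hz using hz
  refine TGood.ext i' q' r z ?_ hr ?_ hz hB hg
  · intro x y h
    exact hi (congrArg Subtype.val h)
  · intro b
    apply Subtype.ext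
    exact hQi b

lemma exists_hom (p : ℕ) {G : Type*} [AddCommGroup G] (u : G) (hu : p • u = 0) :
    ∃ φ : ZMod p →+ G, ∀ k : ℕ, φ k = k • u := by
  refine ⟨ZMod.lift p ⟨zmultiplesHom G u, by simpa using hu⟩, ?_⟩
  intro k
  have := ZMod.lift_coe p (⟨zmultiplesHom G u, by simpa using hu⟩ : {f : ℤ →+ G // f p = 0}) (k : ℤ)
  simpa using this

open Classical in
lemma exists_concl (n : ℕ) : ∀ (G : Type u) [AddCommGroup G] [Finite G], Nat.card G ≤ n →
    ∀ t : G, Uniq t → Concl G t := by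
  induction n with
  | zero =>
    intro G _ _ h
    have := Nat.card_pos (α := G)
    omega
  | succ n ih =>
    intro G _ _ hcard t ht
    have := Fintype.ofFinite G
    by_cases hc : ∀ p : ℕ, p.Prime → (Finset.univ.filter (fun x : G => p • x = 0)).card ≤ p
    · exact Concl.of_cyclic t ht (cyc_crit G hc)
    push Not at hc
    obtain ⟨p, hp, hlt⟩ := hc
    have red : ∀ (B : Type) [AddCommGroup B] [Finite B] [Nontrivial B] (i : B →+ G),
        Function.Injective i → TGood B → Concl G t := by
      intro B _ _ _ i hi hB
      refine Concl.step t ht i hi hB (ih (G ⧸ i.range) ?_)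
      have h1 := AddSubgroup.card_eq_card_quotient_mul_card_addSubgroup i.range
      have h2 : Nat.card i.range = Nat.card B :=
        (Nat.card_congr (AddMonoidHom.ofInjective hi).toEquiv).symm
      have h3 : 1 < Nat.card B := Finite.one_lt_card
      have h4 : 0 < Nat.card (G ⧸ i.range) := Nat.card_pos
      have h5 : Nat.card (G ⧸ i.range) * 2 ≤ Nat.card (G ⧸ i.range) * Nat.card i.range :=
        Nat.mul_le_mul_left _ (by omega)
      omega
    by_cases h2 : p = 2
    · subst h2
      exfalso
      have : (Finset.univ.filter (fun x : G => 2 • x = 0)) ⊆ {0, t} := by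
        intro x hx
        simp only [Finset.mem_filter, Finset.mem_univ, true_and, two_nsmul] at hx
        have := ht.2.2 x hx
        simpa using this
      have := (Finset.card_le_card this).trans Finset.card_le_two
      omega
    have hex : ∃ u : G, p • u = 0 ∧ u ≠ 0 := by
      by_contra hcon
      push Not at hcon
      have : (Finset.univ.filter (fun x : G => p • x = 0)) ⊆ {0} := by
        intro x hx
        simp only [Finset.mem_filter, Finset.mem_univ, true_and] at hx
        simpa using hcon x hx
      have := (Finset.card_le_card this)
      have := hp.two_le
      simp at *
      omega
    obtain ⟨u, hu, hu0⟩ := hex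
    obtain ⟨φ, hφ⟩ := exists_hom p u hu
    by_cases h3 : p = 3
    · subst h3
      have hex : ∃ v : G, 3 • v = 0 ∧ v ≠ 0 ∧ v ≠ u ∧ v ≠ 2 • u := by
        by_contra hcon
        push Not at hcon
        have : (Finset.univ.filter (fun x : G => 3 • x = 0)) ⊆ {0, u, 2 • u} := by
          intro x hx
          simp only [Finset.mem_filter, Finset.mem_univ, true_and] at hx
          have := hcon x hx
          simp only [Finset.mem_insert, Finset.mem_singleton]
          tauto
        have := (Finset.card_le_card this).trans Finset.card_le_three
        omega
      obtain ⟨v, hv, hv0, hvu, hv2⟩ := hex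
      obtain ⟨ψ, hψ⟩ := exists_hom 3 v hv
      refine red (ZMod 3 × ZMod 3) (φ.coprod ψ) ?_ TGood.z33
      rw [injective_iff_map_eq_zero]
      rintro ⟨a, b⟩ hab
      rw [AddMonoidHom.coprod_apply] at hab
      simp only at hab
      have ha : φ a = a.val • u := by rw [← hφ, ZMod.natCast_zmod_val]
      have hb : ψ b = b.val • v := by rw [← hψ, ZMod.natCast_zmod_val]
      rw [ha, hb] at hab
      have ea := ZMod.val_lt a
      have eb := ZMod.val_lt b
      have ea' : a.val = 0 ∨ a.val = 1 ∨ a.val = 2 := by omega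
      have eb' : b.val = 0 ∨ b.val = 1 ∨ b.val = 2 := by omega
      have fin : a.val = 0 ∧ b.val = 0 → (a, b) = 0 := by
        rintro ⟨h1, h2⟩
        rw [(ZMod.val_eq_zero a).1 h1, (ZMod.val_eq_zero b).1 h2]; rfl
      apply fin
      have k1 : ∀ x : G, 3 • x = 0 → 2 • x = -x := by
        intro x hx
        rw [eq_neg_iff_add_eq_zero, ← hx]; abel
      have ku := k1 u hu
      have kv := k1 v hv
      rw [ku] at hv2
      rcases ea' with h | h | h <;> rcases eb' with h' | h' | h' <;> rw [h, h'] at hab ⊢ <;>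
        simp only [zero_smul, one_smul, ku, kv, zero_add, add_zero, neg_eq_zero] at hab <;>
        first
        | exact ⟨rfl, rfl⟩
        | exact absurd hab hu0
        | exact absurd hab hv0
        | (exfalso; apply hv2; rw [← sub_eq_zero, ← hab]; abel1)
        | (exfalso; apply hvu; rw [← sub_eq_zero, ← neg_eq_zero, ← hab]; abel1)
        | (exfalso; apply hvu; rw [← sub_eq_zero, ← hab]; abel1)
        | (exfalso; apply hv2; rw [← sub_eq_zero, ← neg_eq_zero, ← hab]; abel1)
    · have h5 : 5 ≤ p := by
        have := hp.two_le
        by_contra hcon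
        have : p = 4 := by omega
        subst this
        revert hp; norm_num
      have := Fact.mk hp
      refine red (ZMod p) φ ?_ (TGood.zmod p hp h5)
      rw [injective_iff_map_eq_zero]
      intro a ha
      rw [← ZMod.natCast_zmod_val a, hφ] at ha
      have ho : addOrderOf u = p := addOrderOf_eq_prime hu hu0
      have := addOrderOf_dvd_of_nsmul_eq_zero ha
      rw [ho] at this
      exact (ZMod.val_eq_zero a).1 (Nat.eq_zero_of_dvd_of_lt this (ZMod.val_lt a))

lemma sylow_uniq {G : Type*} [CommGroup G] [Finite G] (P : Sylow 2 G)
    (hcyc : IsCyclic ↥(P : Subgroup G)) (hnt : (P : Subgroup G) ≠ ⊥) :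
    ∃ t : Additive G, Uniq t := by
  classical
  have hmem : ∀ x : G, x * x = 1 → x ∈ (P : Subgroup G) := by
    intro x hx
    have h1 : IsPGroup 2 (Subgroup.zpowers x) := by
      rw [IsPGroup.iff_card]
      have : orderOf x ∣ 2 ^ 1 := orderOf_dvd_of_pow_eq_one (by rw [pow_one, pow_two, hx])
      obtain ⟨k, -, hk⟩ := (Nat.dvd_prime_pow Nat.prime_two).1 this
      exact ⟨k, by rw [Nat.card_zpowers, hk]⟩
    obtain ⟨Q, hQ⟩ := h1.exists_le_sylow
    have : Subsingleton (Sylow 2 G) := by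
      have := Sylow.unique_of_normal P inferInstance
      infer_instance
    rw [Subsingleton.elim P Q]
    exact hQ (Subgroup.mem_zpowers x)
  have hpg := P.isPGroup'
  obtain ⟨k, hk⟩ := IsPGroup.iff_card.1 hpg
  have hk0 : k ≠ 0 := by
    rintro rfl
    apply hnt
    rw [← Subgroup.card_eq_one]
    simpa using hk
  obtain ⟨t, ht⟩ := exists_prime_orderOf_dvd_card' (G := (P : Subgroup G)) 2
    (by rw [hk]; exact dvd_pow_self 2 hk0)
  have ht1 : t ≠ 1 := by
    rintro rfl
    simp at ht
  have ht2 : t * t = 1 := by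
    have h := pow_orderOf_eq_one t
    rw [ht] at h
    rw [← pow_two, h]
  have := Fintype.ofFinite (P : Subgroup G)
  have hle := IsCyclic.card_pow_eq_one_le (α := (P : Subgroup G)) (n := 2) (by norm_num)
  have hP : ∀ y : (P : Subgroup G), y * y = 1 → y = 1 ∨ y = t := by
    intro y hy
    by_contra hcon
    push Not at hcon
    have hsub : ({1, t, y} : Finset (P : Subgroup G)) ⊆ Finset.univ.filter (fun a => a ^ 2 = 1) := by
      intro a ha
      simp only [Finset.mem_insert, Finset.mem_singleton] at ha
      simp only [Finset.mem_filter, Finset.mem_univ, true_and, pow_two]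
      rcases ha with rfl | rfl | rfl
      · simp
      · exact ht2
      · exact hy
    have h3 : ({1, t, y} : Finset (P : Subgroup G)).card = 3 := by
      rw [Finset.card_eq_three]
      exact ⟨1, t, y, ht1.symm, hcon.1.symm, hcon.2.symm, rfl⟩
    have := Finset.card_le_card hsub
    omega
  refine ⟨Additive.ofMul (t : G), ?_, ?_, ?_⟩
  · intro h
    apply ht1
    apply Subtype.ext
    exact h
  · exact congrArg (fun x : (P : Subgroup G) => Additive.ofMul (x : G)) ht2
  · intro x hx
    have hx' : (Additive.toMul x) * (Additive.toMul x) = 1 := hx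
    rcases hP ⟨Additive.toMul x, hmem _ hx'⟩ (Subtype.ext hx') with h | h
    · left; exact congrArg Subtype.val h
    · right; exact congrArg Subtype.val h

theorem abelian_cyclic_sylow_two_chromatic_le {G : Type*} [CommGroup G] [Fintype G]
    {n : ℕ} (hn : Fintype.card G = n) (P : Sylow 2 G)
    (hcyc : IsCyclic ↥(P : Subgroup G)) (hnt : (P : Subgroup G) ≠ ⊥) :
    (cayleyGraph G).chromaticNumber ≤ (n : ℕ∞) + 2 := by
  classical
  obtain ⟨t, ht⟩ := sylow_uniq P hcyc hnt
  obtain ⟨N, hN, f, hf, hft, hg⟩ := exists_concl _ (Additive G) le_rfl t ht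
  obtain ⟨col, hcol⟩ := main_color hN f hf t ht.2.1 hft hg
  have hcard : Nat.card ((Fin N × f.ker × Bool) ⊕ Bool) = n + 2 := by
    have h1 := AddSubgroup.card_eq_card_quotient_mul_card_addSubgroup f.ker
    have h2 : Nat.card (Additive G ⧸ f.ker) = 2 * N := by
      rw [Nat.card_congr (QuotientAddGroup.quotientKerEquivOfSurjective f hf).toEquiv, Nat.card_zmod]
    have h3 : Nat.card (Additive G) = n := by
      rw [← hn, ← Nat.card_eq_fintype_card]; rfl
    rw [Nat.card_sum, Nat.card_prod, Nat.card_prod]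
    simp only [Nat.card_eq_fintype_card (α := Bool), Fintype.card_bool, Nat.card_eq_fintype_card (α := Fin N), Fintype.card_fin]
    rw [← h3, h1, h2]; ring
  have := Fintype.ofFinite ((Fin N × f.ker × Bool) ⊕ Bool)
  let C : (cayleyGraph G).Coloring ((Fin N × f.ker × Bool) ⊕ Bool) :=
    SimpleGraph.Coloring.mk (fun p => col (Additive.ofMul p.1, Additive.ofMul p.2)) (by
      intro p q hpq heq
      rw [cayleyGraph, SimpleGraph.fromRel_adj] at hpq
      obtain ⟨hne, hor⟩ := hpq
      have hor' : p.1 = q.1 ∨ p.2 = q.2 ∨ p.1 * p.2 = q.1 * q.2 := by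
        simp only [ExactlyOne] at hor
        rcases hor with (h | h | h) | (h | h | h)
        · exact Or.inl h.1
        · exact Or.inr (Or.inl h.2.1)
        · exact Or.inr (Or.inr h.2.2)
        · exact Or.inl h.1.symm
        · exact Or.inr (Or.inl h.2.1.symm)
        · exact Or.inr (Or.inr h.2.2.symm)
      apply hne
      have := hcol _ _ heq hor'
      exact Prod.ext (congrArg Prod.fst this) (congrArg Prod.snd this))
  have hc := C.colorable
  rw [← Nat.card_eq_fintype_card, hcard] at hc
  exact_mod_cast hc.chromaticNumber_le
end

section
/- Let G be a finite group and let H be a normal subgroup of G. Then χ(G) ≤ χ(H) · χ(G/H). -/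
theorem cayley_adj_iff {G : Type*} [Group G] (p q : G × G) :
    (cayleyGraph G).Adj p q ↔
      p ≠ q ∧ (p.1 = q.1 ∨ p.2 = q.2 ∨ p.1 * p.2 = q.1 * q.2) := by
  obtain ⟨a, b⟩ := p
  obtain ⟨c, d⟩ := q
  simp only [cayleyGraph, SimpleGraph.fromRel_adj, ExactlyOne, ne_eq, Prod.mk.injEq]
  by_cases h1 : a = c
  · subst h1
    by_cases h2 : b = d
    · simp [h2]
    · simp [h2, Ne.symm h2]
  · by_cases h2 : b = d
    · subst h2
      simp [h1, Ne.symm h1]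
    · simp [h1, h2, Ne.symm h1, Ne.symm h2, eq_comm]

theorem cayley_colorable {G : Type*} [Group G] (H : Subgroup G) [hN : H.Normal] {m n : ℕ}
    (hm : (cayleyGraph H).Colorable m) (hn : (cayleyGraph (G ⧸ H)).Colorable n) :
    (cayleyGraph G).Colorable (m * n) := by
  obtain ⟨f⟩ := hm
  obtain ⟨g⟩ := hn
  let r : G ⧸ H → G := Quotient.out
  have hr : ∀ A : G ⧸ H, ((r A : G) : G ⧸ H) = A := fun A => Quotient.out_eq' A
  have hL : ∀ a : G, (r (a : G ⧸ H))⁻¹ * a ∈ H := fun a =>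
    QuotientGroup.eq.1 (hr a)
  have hR : ∀ a : G, a * (r (a : G ⧸ H))⁻¹ ∈ H := fun a => hN.mem_comm (hL a)
  let C : (cayleyGraph G).Coloring (Fin m × Fin n) := SimpleGraph.Coloring.mk
    (fun p => (f (⟨_, hL p.1⟩, ⟨_, hR p.2⟩), g ((p.1 : G ⧸ H), (p.2 : G ⧸ H)))) (by
      rintro ⟨a, b⟩ ⟨c, d⟩ hadj heq
      rw [cayley_adj_iff] at hadj
      obtain ⟨hne, hor⟩ := hadj
      simp only [Prod.mk.injEq] at heq hor
      obtain ⟨h1, h2⟩ := heq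
      by_cases hq : (((a : G ⧸ H), (b : G ⧸ H)) : (G ⧸ H) × (G ⧸ H)) = ((c : G ⧸ H), (d : G ⧸ H))
      · simp only [Prod.mk.injEq] at hq
        obtain ⟨hA, hB⟩ := hq
        refine f.valid ((cayley_adj_iff _ _).2 ⟨?_, ?_⟩) h1
        · intro h
          simp only [Prod.mk.injEq, Subtype.mk.injEq, hA, hB] at h
          exact hne (Prod.ext (mul_left_cancel h.1) (mul_right_cancel h.2))
        · rcases hor with h | h | h
          · left; simp [h]
          · right; left; simp [h]
          · right; right
            apply Subtype.ext
            simp only [Subgroup.coe_mul, hA, hB]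
            calc _ = (r (c : G ⧸ H))⁻¹ * (a * b) * (r (d : G ⧸ H))⁻¹ := by group
              _ = _ := by rw [h]; group
      · refine g.valid ((cayley_adj_iff _ _).2 ⟨hq, ?_⟩) h2
        rcases hor with h | h | h
        · left; simp [h]
        · right; left; simp [h]
        · right; right
          simp only [← QuotientGroup.mk_mul, h])
  simpa using C.colorable

theorem chromatic_submultiplicative {G : Type*} [Group G] [Fintype G]
    (H : Subgroup G) [H.Normal] :
    (cayleyGraph G).chromaticNumber ≤
      (cayleyGraph H).chromaticNumber * (cayleyGraph (G ⧸ H)).chromaticNumber := by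
  have : Finite (G ⧸ H) := Quotient.finite _
  have := Fintype.ofFinite H
  have := Fintype.ofFinite (G ⧸ H)
  obtain ⟨m, hm⟩ := ENat.ne_top_iff_exists.1
    (SimpleGraph.chromaticNumber_ne_top_iff_exists.2
      ⟨_, SimpleGraph.colorable_of_fintype (cayleyGraph H)⟩)
  obtain ⟨n, hn⟩ := ENat.ne_top_iff_exists.1
    (SimpleGraph.chromaticNumber_ne_top_iff_exists.2
      ⟨_, SimpleGraph.colorable_of_fintype (cayleyGraph (G ⧸ H))⟩)
  have h1 := SimpleGraph.chromaticNumber_le_iff_colorable.1 hm.symm.le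
  have h2 := SimpleGraph.chromaticNumber_le_iff_colorable.1 hn.symm.le
  rw [← hm, ← hn]
  exact_mod_cast (cayley_colorable H h1 h2).chromaticNumber_le
end

section
/- Let G be a finite abelian group of order n = t·m, where t = 2^l ≥ 2, m is odd, and the Sylow 2-subgroups of G are cyclic, so that G ≅ ZMod t × H with H = ZMod m₁ × … × ZMod m_k of odd order m. Enumerate H = {h₀, …, h_{m−1}} lexicographically and define g_i := (i mod t, h_{i mod m}) for i ∈ {0,…,n−1} (a bijection from {0,…,n−1} to G by the Chinese remainder theorem). Index the cells of the Cayley table of G by pairs (i,j) with symbol g_i + g_j, let T_d := {(i, (i+d) mod n) : i ∈ {0,…,n−1}} be the d-th right diagonal, and let D_i := T_{2i} ∪ T_{2i+1}. Then for every i ∈ {0, …, n/2 − 1}, the subgraph of the Cayley table graph Γ(G) induced on D_i is isomorphic to the Möbius ladder M_n. -/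
/-- The latin square graph of an `n × n` array of symbols in `S`: distinct cells are
adjacent iff exactly one of same row, same column, same symbol holds. -/
def cellGraph {n : ℕ} {S : Type*} (L : Fin n → Fin n → S) : SimpleGraph (Fin n × Fin n) :=
  SimpleGraph.fromRel fun p q =>
    ExactlyOne (p.1 = q.1) (p.2 = q.2) (L p.1 p.2 = L q.1 q.2)

/-- The Möbius ladder of order `2 * n`: the circulant graph on `ZMod (2 * n)` in which
`x` and `y` are adjacent iff `y - x ∈ {1, -1, n}`. -/
def mobiusLadder (n : ℕ) : SimpleGraph (ZMod (2 * n)) :=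
  SimpleGraph.fromRel fun x y =>
    y - x = 1 ∨ y - x = -1 ∨ y - x = (n : ZMod (2 * n))

def lexRank : (k : ℕ) → (mv : Fin k → ℕ) → ((i : Fin k) → ZMod (mv i)) → ℕ
  | 0, _, _ => 0
  | k + 1, mv, f =>
      (f 0).val * (∏ i : Fin k, mv i.succ) + lexRank k (fun i => mv i.succ) (fun i => f i.succ)

theorem lexRank_lt : ∀ (k : ℕ) (mv : Fin k → ℕ) (_ : ∀ i, 0 < mv i)
    (f : (i : Fin k) → ZMod (mv i)), lexRank k mv f < ∏ i, mv i
  | 0, _, _, _ => by simp [lexRank]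
  | k + 1, mv, hp, f => by
      have ih := lexRank_lt k (fun i => mv i.succ) (fun i => hp _) (fun i => f i.succ)
      have : NeZero (mv 0) := ⟨(hp 0).ne'⟩
      have h1 : (f 0).val + 1 ≤ mv 0 := ZMod.val_lt (f 0)
      have h2 := Nat.mul_le_mul_right (∏ i : Fin k, mv i.succ) h1
      rw [Fin.prod_univ_succ]
      simp only [lexRank]
      rw [add_mul, one_mul] at h2
      omega

theorem lexRank_lex : ∀ (k : ℕ) (mv : Fin k → ℕ) (_ : ∀ i, 0 < mv i)
    (f f' : (i : Fin k) → ZMod (mv i)) (r : Fin k) (_ : ∀ s : Fin k, s < r → f s = f' s)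
    (_ : (f r).val < (f' r).val), lexRank k mv f < lexRank k mv f'
  | 0, _, _, _, _, r, _, _ => r.elim0
  | k + 1, mv, hp, f, f', r, hs, hr => by
      have ih := lexRank_lex k (fun i => mv i.succ) (fun i => hp _)
        (fun i => f i.succ) (fun i => f' i.succ)
      have hlt := lexRank_lt k (fun i => mv i.succ) (fun i => hp _) (fun i => f i.succ)
      simp only [lexRank]
      induction r using Fin.cases with
      | zero =>
        have h2 := Nat.mul_le_mul_right (∏ i : Fin k, mv i.succ) hr
        rw [Nat.succ_eq_add_one, add_mul, one_mul] at h2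
        omega
      | succ r =>
        have h0 := hs 0 (Fin.succ_pos r)
        rw [h0]
        have := ih r (fun s hsr => hs s.succ (Fin.succ_lt_succ_iff.2 hsr)) hr
        omega

theorem rank_head (m1 M a r x : ℤ) (hM : 0 < M) (hr0 : 0 ≤ r) (hr : r < M)
    (hx : a * M + r ≡ x [ZMOD (m1 * M)]) : r ≡ x [ZMOD M] ∧ a ≡ x / M [ZMOD m1] := by
  obtain ⟨c, hc⟩ := hx.dvd
  have e : x = r + M * (a + m1 * c) := by linear_combination hc
  subst e
  rw [Int.add_mul_ediv_left _ _ hM.ne', Int.ediv_eq_zero_of_lt hr0 hr]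
  constructor
  · exact (Int.modEq_iff_dvd.2 ⟨a + m1 * c, by ring⟩)
  · exact (Int.modEq_iff_dvd.2 ⟨c, by ring⟩)

theorem lexRank_inj : ∀ (k : ℕ) (mv : Fin k → ℕ) (_ : ∀ i, Odd (mv i))
    (f1 f2 f3 f4 : (i : Fin k) → ZMod (mv i)) (x y d : ℤ)
    (_ : (lexRank k mv f1 : ℤ) ≡ x [ZMOD ((∏ i, mv i : ℕ) : ℤ)])
    (_ : (lexRank k mv f2 : ℤ) ≡ x + d [ZMOD ((∏ i, mv i : ℕ) : ℤ)])
    (_ : (lexRank k mv f3 : ℤ) ≡ y [ZMOD ((∏ i, mv i : ℕ) : ℤ)])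
    (_ : (lexRank k mv f4 : ℤ) ≡ y + d [ZMOD ((∏ i, mv i : ℕ) : ℤ)])
    (_ : f1 + f2 = f3 + f4), ((∏ i, mv i : ℕ) : ℤ) ∣ y - x
  | 0, _, _, _, _, _, _, _, _, _, _, _, _, _, _ => by simp
  | k + 1, mv, ho, f1, f2, f3, f4, x, y, d, h1, h2, h3, h4, he => by
      have hp : ∀ i, 0 < mv i := fun i => (ho i).pos
      have : NeZero (mv 0) := ⟨(hp 0).ne'⟩
      have hlt := lexRank_lt k (fun i => mv i.succ) (fun i => hp _)
      have hM : 0 < ∏ i : Fin k, mv i.succ := Finset.prod_pos fun i _ => hp _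
      simp only [lexRank, Fin.prod_univ_succ] at h1 h2 h3 h4 ⊢
      push_cast only [Nat.cast_mul, Nat.cast_add] at h1 h2 h3 h4 ⊢
      have key := fun (f : (i : Fin (k+1)) → ZMod (mv i)) (z : ℤ) => rank_head (mv 0 : ℤ)
        ((∏ i : Fin k, mv i.succ : ℕ) : ℤ) ((f 0).val : ℤ)
        (lexRank k (fun i => mv i.succ) (fun i => f i.succ) : ℤ) z (by exact_mod_cast hM)
        (by positivity) (by exact_mod_cast hlt _)
      have k1 := key f1 _ h1
      have k2 := key f2 _ h2
      have k3 := key f3 _ h3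
      have k4 := key f4 _ h4
      have ih := lexRank_inj k (fun i => mv i.succ) (fun i => ho _) (fun i => f1 i.succ)
        (fun i => f2 i.succ) (fun i => f3 i.succ) (fun i => f4 i.succ) x y d k1.1 k2.1 k3.1 k4.1
        (by funext i; exact congrFun he i.succ)
      have hM' : ((∏ i : Fin k, mv i.succ : ℕ) : ℤ) ≠ 0 := by exact_mod_cast hM.ne'
      generalize ((∏ i : Fin k, mv i.succ : ℕ) : ℤ) = M at *
      obtain ⟨q, hq⟩ := ih
      have ey : y = x + M * q := by linarith
      have eyd : y + d = (x + d) + M * q := by linarith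
      have kk3 := k3.2
      have kk4 := k4.2
      rw [ey, Int.add_mul_ediv_left _ _ hM'] at kk3
      rw [eyd, Int.add_mul_ediv_left _ _ hM'] at kk4
      have t1 := (ZMod.intCast_eq_intCast_iff _ _ _).2 k1.2
      have t2 := (ZMod.intCast_eq_intCast_iff _ _ _).2 k2.2
      have t3 := (ZMod.intCast_eq_intCast_iff _ _ _).2 kk3
      have t4 := (ZMod.intCast_eq_intCast_iff _ _ _).2 kk4
      have e0 : f1 0 + f2 0 = f3 0 + f4 0 := congrFun he 0
      push_cast [ZMod.natCast_zmod_val] at t1 t2 t3 t4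
      rw [t1, t2, t3, t4] at e0
      have e2 : ((2 * q : ℤ) : ZMod (mv 0)) = 0 := by
        push_cast
        linear_combination -e0
      rw [ZMod.intCast_zmod_eq_zero_iff_dvd] at e2
      have hc : IsCoprime ((mv 0 : ℕ) : ℤ) 2 := by
        have := (Nat.coprime_two_right (n := mv 0)).2 (ho 0)
        exact_mod_cast Nat.isCoprime_iff_coprime.2 this
      have := hc.dvd_of_dvd_mul_left e2
      rw [hq, mul_comm]
      exact mul_dvd_mul_left _ this

theorem dvd_small (n : ℕ) (z : ℤ) (hz : z < 2 * n) (hz' : -(2 * n : ℤ) < z) :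
    (n : ℤ) ∣ z ↔ z = 0 ∨ z = n ∨ z = -n := by
  constructor
  · rintro ⟨c, rfl⟩
    have h1 : c < 2 := by nlinarith
    have h2 : -2 < c := by nlinarith
    have : c = -1 ∨ c = 0 ∨ c = 1 := by omega
    rcases this with rfl | rfl | rfl <;> simp
  · rintro (rfl | rfl | rfl) <;> simp

theorem mod_eq_iff_dvd (n a b : ℕ) : a % n = b % n ↔ (n : ℤ) ∣ (a : ℤ) - b := by
  rw [← Int.modEq_iff_dvd, Int.natCast_modEq_iff]; exact eq_comm

theorem mobius_adj (n : ℕ) (hn : 2 ≤ n) (x y : ZMod (2 * n)) :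
    (mobiusLadder n).Adj x y ↔ (y.val = x.val + 1 ∨ x.val = y.val + 1 ∨ y.val = x.val + n ∨
      x.val = y.val + n ∨ y.val + 1 = x.val + 2 * n ∨ x.val + 1 = y.val + 2 * n) := by
  have : NeZero (2 * n) := ⟨by omega⟩
  have hx := ZMod.val_lt x
  have hy := ZMod.val_lt y
  have hne : x ≠ y ↔ x.val ≠ y.val := (ZMod.val_injective (2 * n)).ne_iff.symm
  have key : ∀ (u w : ZMod (2 * n)) (c : ℤ), w - u = (c : ZMod (2 * n)) ↔
      ((2 * n : ℕ) : ℤ) ∣ (w.val : ℤ) - u.val - c := by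
    intro u w c
    rw [← ZMod.intCast_zmod_eq_zero_iff_dvd]
    push_cast [ZMod.natCast_zmod_val]
    rw [sub_eq_zero]
  have k1 := fun u w => key u w 1
  have k2 := fun u w => key u w (-1)
  have k3 := fun u w => key u w n
  simp only [Int.cast_one, Int.cast_neg, Int.cast_natCast] at k1 k2 k3
  rw [mobiusLadder, SimpleGraph.fromRel_adj, hne, k1, k2, k3, k1, k2, k3]
  rw [dvd_small, dvd_small, dvd_small, dvd_small, dvd_small, dvd_small] <;> push_cast <;> omega

theorem cell_arith (n v w : ℕ) (h2 : 2 ≤ n) (he : n % 2 = 0) (hv : v < 2 * n) (hw : w < 2 * n)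
    (p q r : Prop) (hp : p ↔ v / 2 = w / 2)
    (hq : q ↔ (n : ℤ) ∣ ((v + 1) / 2 : ℕ) - ((w + 1) / 2 : ℕ))
    (hr : r ↔ (n : ℤ) ∣ (v : ℤ) - w) :
    (v ≠ w ∧ ExactlyOne p q r) ↔ (w = v + 1 ∨ v = w + 1 ∨ w = v + n ∨
      v = w + n ∨ w + 1 = v + 2 * n ∨ v + 1 = w + 2 * n) := by
  rw [dvd_small _ _ (by omega) (by omega)] at hq hr
  unfold ExactlyOne
  rw [hp, hq, hr]
  omega

theorem exactlyOne_congr_symm (p q r p' q' r' : Prop) (h : ExactlyOne p q r) (a : p ↔ p')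
    (b : q ↔ q') (c : r ↔ r') : ExactlyOne p' q' r' := by
  rw [← propext a, ← propext b, ← propext c]; exact h

theorem double_diagonal_is_mobius_ladder {l k : ℕ} (hl : 1 ≤ l)
    (mv : Fin k → ℕ) (m : ℕ) (hm : m = ∏ i, mv i) (hmodd : Odd m)
    (n : ℕ) (hn : n = 2 ^ l * m)
    -- `h` is the lexicographic enumeration of `H = ZMod m₁ × ⋯ × ZMod m_k`
    (h : Fin m → ((i : Fin k) → ZMod (mv i)))
    (hbij : Function.Bijective h)
    (hlex : ∀ i j : Fin m, i < j ↔
      ∃ r : Fin k, (∀ s : Fin k, s < r → h i s = h j s) ∧ (h i r).val < (h j r).val)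
    -- `g` enumerates `G = ZMod (2^l) × H` by `g i = (i mod 2^l, h (i mod m))`
    (g : Fin n → ZMod (2 ^ l) × ((i : Fin k) → ZMod (mv i)))
    (hg : ∀ (i : Fin n) (j : Fin m), (i : ℕ) % m = (j : ℕ) →
      g i = (((i : ℕ) : ZMod (2 ^ l)), h j))
    (i : ℕ) (hi : i < n / 2) :
    Nonempty
      (((cellGraph fun x y : Fin n => g x + g y).induce
          {p : Fin n × Fin n |
            (p.2 : ℕ) = ((p.1 : ℕ) + 2 * i) % n ∨
            (p.2 : ℕ) = ((p.1 : ℕ) + 2 * i + 1) % n}) ≃g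
        mobiusLadder n) := by
  have hmpos : 0 < m := hmodd.pos
  have hodd : ∀ i, Odd (mv i) := fun j =>
    Odd.of_dvd_nat (hm ▸ hmodd) (Finset.dvd_prod_of_mem _ (Finset.mem_univ j))
  have hmvp : ∀ i, 0 < mv i := fun i => (hodd i).pos
  have hl2 : 2 ∣ 2 ^ l := dvd_pow_self 2 (by omega)
  have hn2 : 2 ∣ n := hn ▸ hl2.mul_right m
  have hnpos : 0 < n := by rw [hn]; positivity
  have hn2' : 2 ≤ n := Nat.le_of_dvd hnpos hn2
  have hmn : m ∣ n := ⟨2 ^ l, by rw [hn, mul_comm]⟩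
  have hln : 2 ^ l ∣ n := ⟨m, hn⟩
  have : NeZero (2 * n) := ⟨by omega⟩
  -- rank
  have hrank : ∀ j : Fin m, lexRank k mv (h j) = j := by
    let R : Fin m → Fin m := fun j => ⟨lexRank k mv (h j), by
      conv_rhs => rw [hm]
      exact lexRank_lt k mv hmvp _⟩
    have hR : StrictMono R := by
      intro a b hab
      obtain ⟨r, h1, h2⟩ := (hlex a b).1 hab
      exact lexRank_lex k mv hmvp _ _ r h1 h2
    have hid : R = id := by
      refine (hR.range_inj strictMono_id).1 ?_
      rw [Set.range_id, (Finite.injective_iff_surjective.1 hR.injective).range_eq]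
    intro j
    exact congrArg Fin.val (congrFun hid j)
  let hh : ℕ → ((i : Fin k) → ZMod (mv i)) := fun a => h ⟨a % m, Nat.mod_lt _ hmpos⟩
  have hhrank : ∀ a : ℕ, (lexRank k mv (hh a) : ℤ) ≡ a [ZMOD ((∏ i, mv i : ℕ) : ℤ)] := by
    intro a
    rw [← hm, hrank, Int.natCast_modEq_iff]
    exact Nat.mod_modEq a m
  have hhcongr : ∀ a b : ℕ, a % m = b % m → hh a = hh b := by
    intro a b hab
    simp only [hh, hab]
  have hgm : ∀ (a : ℕ) (ha : a % n < n), g ⟨a % n, ha⟩ = ((a : ZMod (2 ^ l)), hh a) := by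
    intro a ha
    rw [hg ⟨a % n, ha⟩ ⟨a % m, Nat.mod_lt _ hmpos⟩ (Nat.mod_mod_of_dvd a hmn)]
    refine Prod.ext ?_ rfl
    exact (ZMod.natCast_eq_natCast_iff _ _ _).2 ((Nat.mod_modEq a n).of_dvd hln)
  have hsym : ∀ v w : ℕ,
      ((((v / 2 : ℕ) : ZMod (2 ^ l)), hh (v / 2)) +
        (((v / 2 + 2 * i + v % 2 : ℕ) : ZMod (2 ^ l)), hh (v / 2 + 2 * i + v % 2)) =
      (((w / 2 : ℕ) : ZMod (2 ^ l)), hh (w / 2)) +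
        (((w / 2 + 2 * i + w % 2 : ℕ) : ZMod (2 ^ l)), hh (w / 2 + 2 * i + w % 2))) ↔
      (n : ℤ) ∣ (v : ℤ) - w := by
    intro v w
    rw [Prod.ext_iff]
    have hfst : (((v / 2 : ℕ) : ZMod (2 ^ l)) + ((v / 2 + 2 * i + v % 2 : ℕ) : ZMod (2 ^ l)) =
        ((w / 2 : ℕ) : ZMod (2 ^ l)) + ((w / 2 + 2 * i + w % 2 : ℕ) : ZMod (2 ^ l))) ↔
        ((2 ^ l : ℕ) : ℤ) ∣ (v : ℤ) - w := by
      rw [← ZMod.intCast_zmod_eq_zero_iff_dvd, ← Nat.cast_add, ← Nat.cast_add,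
        show v / 2 + (v / 2 + 2 * i + v % 2) = v + 2 * i by omega,
        show w / 2 + (w / 2 + 2 * i + w % 2) = w + 2 * i by omega]
      push_cast
      rw [sub_eq_zero, add_left_inj]
    change (_ ∧ hh (v / 2) + hh (v / 2 + 2 * i + v % 2) =
      hh (w / 2) + hh (w / 2 + 2 * i + w % 2)) ↔ _
    rw [show ((((v / 2 : ℕ) : ZMod (2 ^ l)), hh (v / 2)) +
        (((v / 2 + 2 * i + v % 2 : ℕ) : ZMod (2 ^ l)), hh (v / 2 + 2 * i + v % 2))).1 =
        ((v / 2 : ℕ) : ZMod (2 ^ l)) + ((v / 2 + 2 * i + v % 2 : ℕ) : ZMod (2 ^ l)) from rfl,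
      show ((((w / 2 : ℕ) : ZMod (2 ^ l)), hh (w / 2)) +
        (((w / 2 + 2 * i + w % 2 : ℕ) : ZMod (2 ^ l)), hh (w / 2 + 2 * i + w % 2))).1 =
        ((w / 2 : ℕ) : ZMod (2 ^ l)) + ((w / 2 + 2 * i + w % 2 : ℕ) : ZMod (2 ^ l)) from rfl,
      hfst]
    have hcop : IsCoprime ((2 ^ l : ℕ) : ℤ) (m : ℤ) :=
      Nat.isCoprime_iff_coprime.2 (Nat.Coprime.pow_left l (Nat.coprime_two_left.2 hmodd))
    have hcop2 : IsCoprime (m : ℤ) (2 : ℤ) := by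
      exact_mod_cast Nat.isCoprime_iff_coprime.2 (Nat.coprime_two_right.2 hmodd)
    constructor
    · rintro ⟨h1, h2⟩
      have hpar : (2 : ℤ) ∣ (v : ℤ) - w := dvd_trans (by exact_mod_cast hl2) h1
      have hb : w % 2 = v % 2 := by omega
      rw [hb] at h2
      have := lexRank_inj k mv hodd _ _ _ _ ((v / 2 : ℕ) : ℤ) ((w / 2 : ℕ) : ℤ)
        ((2 * i + v % 2 : ℕ) : ℤ) (hhrank _) (by rw [← Nat.cast_add, ← add_assoc]; exact hhrank _)
        (hhrank _) (by rw [← Nat.cast_add, ← add_assoc]; exact hhrank _) h2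
      rw [← hm] at this
      have hmd : (m : ℤ) ∣ (v : ℤ) - w := by
        have e : (v : ℤ) - w = ((w / 2 : ℕ) - (v / 2 : ℕ) : ℤ) * (-2) := by omega
        rw [e]
        exact this.mul_right _
      rw [hn, Nat.cast_mul]
      exact hcop.mul_dvd h1 hmd
    · intro hd
      have h1 : ((2 ^ l : ℕ) : ℤ) ∣ (v : ℤ) - w := dvd_trans (Int.natCast_dvd_natCast.2 hln) hd
      have hmd : (m : ℤ) ∣ (v : ℤ) - w := dvd_trans (Int.natCast_dvd_natCast.2 hmn) hd
      have hpar : (2 : ℤ) ∣ (v : ℤ) - w := dvd_trans (by exact_mod_cast hl2) h1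
      have hb : w % 2 = v % 2 := by omega
      have hq : (m : ℤ) ∣ ((v / 2 : ℕ) - (w / 2 : ℕ) : ℤ) := by
        apply hcop2.dvd_of_dvd_mul_left
        have e : (2 * ((v / 2 : ℕ) - (w / 2 : ℕ)) : ℤ) = (v : ℤ) - w := by omega
        rw [e]; exact hmd
      refine ⟨h1, ?_⟩
      rw [hb, hhcongr _ _ ((mod_eq_iff_dvd m (v / 2) (w / 2)).2 hq),
        hhcongr (v / 2 + 2 * i + v % 2) (w / 2 + 2 * i + v % 2)]
      rw [mod_eq_iff_dvd]
      convert hq using 1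
      push_cast; ring
  -- the map
  let c : ℕ → Fin n × Fin n := fun v =>
    (⟨(v / 2) % n, Nat.mod_lt _ hnpos⟩, ⟨(v / 2 + 2 * i + v % 2) % n, Nat.mod_lt _ hnpos⟩)
  have hrow : ∀ v w : ℕ, v < 2 * n → w < 2 * n → ((c v).1 = (c w).1 ↔ v / 2 = w / 2) := by
    intro v w hv hw
    simp only [c, Fin.mk.injEq]
    rw [Nat.mod_eq_of_lt (by omega), Nat.mod_eq_of_lt (by omega)]
  have hcol : ∀ v w : ℕ, (c v).2 = (c w).2 ↔
      (n : ℤ) ∣ ((v + 1) / 2 : ℕ) - ((w + 1) / 2 : ℕ) := by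
    intro v w
    simp only [c, Fin.mk.injEq]
    rw [mod_eq_iff_dvd]
    have e : ((v / 2 + 2 * i + v % 2 : ℕ) : ℤ) - (w / 2 + 2 * i + w % 2 : ℕ) =
      ((v + 1) / 2 : ℕ) - ((w + 1) / 2 : ℕ) := by omega
    rw [e]
  have hsy : ∀ v w : ℕ, g (c v).1 + g (c v).2 = g (c w).1 + g (c w).2 ↔
      (n : ℤ) ∣ (v : ℤ) - w := by
    intro v w
    rw [← hsym v w]
    simp only [c, hgm]
  have hcinj : ∀ v w : ℕ, v < 2 * n → w < 2 * n → (c v = c w ↔ v = w) := by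
    intro v w hv hw
    refine ⟨fun hc => ?_, fun hc => by rw [hc]⟩
    have a1 := (hrow v w hv hw).1 (by rw [hc])
    have a2 := (hsy v w).1 (by rw [hc])
    rw [dvd_small _ _ (by omega) (by omega)] at a2
    omega
  let φ : ZMod (2 * n) → {p : Fin n × Fin n |
            (p.2 : ℕ) = ((p.1 : ℕ) + 2 * i) % n ∨
            (p.2 : ℕ) = ((p.1 : ℕ) + 2 * i + 1) % n} := fun s => ⟨c s.val, by
    have hs := ZMod.val_lt s
    simp only [c, Set.mem_ofPred_eq]
    rw [Nat.mod_eq_of_lt (show s.val / 2 < n by omega)]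
    rcases Nat.mod_two_eq_zero_or_one s.val with e | e <;> simp [e]⟩
  have hφ : Function.Bijective φ := by
    constructor
    · intro s s' he
      exact ZMod.val_injective _
        ((hcinj _ _ (ZMod.val_lt s) (ZMod.val_lt s')).1 (congrArg Subtype.val he))
    · rintro ⟨⟨x, y⟩, hxy⟩
      have hx := x.2
      rcases hxy with e | e
      · refine ⟨((2 * x.val : ℕ) : ZMod (2 * n)), Subtype.ext ?_⟩
        simp only [φ, c]
        rw [ZMod.val_natCast_of_lt (by omega)]
        refine Prod.ext (Fin.ext ?_) (Fin.ext ?_)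
        · simp only []
          rw [Nat.mod_eq_of_lt] <;> omega
        · simp only [] at e ⊢
          rw [e]
          congr 1; omega
      · refine ⟨((2 * x.val + 1 : ℕ) : ZMod (2 * n)), Subtype.ext ?_⟩
        simp only [φ, c]
        rw [ZMod.val_natCast_of_lt (by omega)]
        refine Prod.ext (Fin.ext ?_) (Fin.ext ?_)
        · simp only []
          rw [Nat.mod_eq_of_lt] <;> omega
        · simp only [] at e ⊢
          rw [e]
          congr 1; omega
  refine ⟨RelIso.symm ⟨Equiv.ofBijective φ hφ, ?_⟩⟩
  intro s s'
  have hs := ZMod.val_lt s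
  have hs' := ZMod.val_lt s'
  rw [mobius_adj n hn2' s s', ← cell_arith n s.val s'.val hn2' (by omega) hs hs' _ _ _
    (hrow _ _ hs hs') (hcol _ _) (hsy _ _)]
  change (cellGraph fun x y : Fin n => g x + g y).Adj (c s.val) (c s'.val) ↔ _
  rw [cellGraph, SimpleGraph.fromRel_adj, Ne, hcinj _ _ hs hs']
  refine and_congr_right fun _ => ⟨?_, Or.inl⟩
  rintro (e | e)
  · exact e
  · exact exactlyOne_congr_symm _ _ _ _ _ _ e eq_comm eq_comm eq_comm
end

section
/- Let G be a finite group, let H be a normal subgroup of G, and let f₁, f₂ ∈ G. Then the subgraph of the Cayley table graph Γ(G) induced on the set of cells {(f₁·h, f₂·h') : h, h' ∈ H} ⊆ G × G is isomorphic to the Cayley table graph Γ(H). -/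
theorem coset_block_iso_subgroup_cayley {G : Type*} [Group G] [Fintype G]
    (H : Subgroup G) [H.Normal] (f₁ f₂ : G) :
    Nonempty
      (((cayleyGraph G).induce
          {p : G × G | ∃ h ∈ H, ∃ h' ∈ H, p = (f₁ * h, f₂ * h')}) ≃g
        cayleyGraph H) := by
  have hN : H.Normal := inferInstance
  let S : Set (G × G) := {p : G × G | ∃ h ∈ H, ∃ h' ∈ H, p = (f₁ * h, f₂ * h')}
  let φ : H × H → S := fun k =>
    ⟨(f₁ * (f₂ * (k.1 : G) * f₂⁻¹), f₂ * (k.2 : G)),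
      f₂ * (k.1 : G) * f₂⁻¹, hN.conj_mem _ k.1.2 f₂, k.2, k.2.2, rfl⟩
  have hφ : Function.Bijective φ := by
    constructor
    · rintro ⟨⟨a, ha⟩, ⟨b, hb⟩⟩ ⟨⟨c, hc⟩, ⟨d, hd⟩⟩ h
      simpa [φ] using h
    · rintro ⟨p, h, hh, h', hh', rfl⟩
      refine ⟨(⟨f₂⁻¹ * h * f₂, by simpa using hN.conj_mem _ hh f₂⁻¹⟩, ⟨h', hh'⟩), ?_⟩
      simp [φ, mul_assoc]
  refine ⟨RelIso.symm ⟨Equiv.ofBijective φ hφ, ?_⟩⟩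
  rintro ⟨⟨a, ha⟩, ⟨b, hb⟩⟩ ⟨⟨c, hc⟩, ⟨d, hd⟩⟩
  simp [φ, cayleyGraph, ExactlyOne, mul_assoc]
end
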